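/- Let Φ={φ_i}_{i∈Λ} be an analytic IFS on I=[0,1] with 0<|φ_i'(x)|<1 for all i∈Λ and x∈I, whose maps have no common fixed point, let p be a positive probability vector and μ the associated exact dimensional self-conformal measure. For each 0<ε<1 there exists M(ε)≥1 such that for all m≥M(ε) and all n≥1 the following holds: if ψ:I→ℝ is C¹ with ε ≤ |ψ'(x)| ≤ ε^{-1} for all x∈I, then, setting θ:=ψμ, ℙ( (1/m)H(θ_{x,n}, D_{n+m}) > dim μ − ε ) > 1−ε, where x is distributed according to θ. -/

import Mathlib

open MeasureTheory Filter Set Metric Topology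

noncomputable section

/-- The unit interval `I = [0,1]`. -/
def unitI : Set ℝ := Set.Icc 0 1

/-- For a word `u = i₁…iₙ`, `compWord φ u = φ_{i₁} ∘ … ∘ φ_{iₙ}`. -/
def compWord {Λ : Type*} (φ : Λ → ℝ → ℝ) : List Λ → ℝ → ℝ
  | [] => id
  | i :: u => φ i ∘ compWord φ u

/-- `μ` is exact dimensional with dimension `d`. -/
def ExactDimWith (μ : Measure ℝ) (d : ℝ) : Prop :=
  ∀ᵐ x ∂μ, Tendsto (fun δ : ℝ =>
      Real.log (μ (Metric.closedBall x δ)).toReal / Real.log δ)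
    (nhdsWithin 0 (Set.Ioi 0)) (nhds d)

/-- The level-`n` dyadic interval `[m/2^n, (m+1)/2^n)`. -/
def dyadIco (n : ℕ) (m : ℤ) : Set ℝ :=
  Set.Ico ((m : ℝ) / 2 ^ n) (((m : ℝ) + 1) / 2 ^ n)

/-- Entropy of a measure on `ℝ` with respect to the level-`n` dyadic partition
(logarithms in base 2). -/
def ent1 (n : ℕ) (θ : Measure ℝ) : ℝ :=
  -∑' m : ℤ, (θ (dyadIco n m)).toReal * Real.logb 2 (θ (dyadIco n m)).toReal

/-- The level-`n` dyadic cell containing `x`. -/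
def dcell (n : ℕ) (x : ℝ) : Set ℝ := dyadIco n ⌊x * 2 ^ n⌋

/-- The level-`n` component `θ_{x,n}`: `θ` conditioned on the dyadic cell of `x`. -/
def dcomp (θ : Measure ℝ) (x : ℝ) (n : ℕ) : Measure ℝ :=
  (θ (dcell n x))⁻¹ • θ.restrict (dcell n x)

lemma compWord_append_singleton {Λ : Type*} (φ : Λ → ℝ → ℝ) (u : List Λ) (i : Λ) :
    compWord φ (u ++ [i]) = compWord φ u ∘ φ i := by
  induction u with
  | nil => rfl
  | cons j u ih =>
    change φ j ∘ compWord φ (u ++ [i]) = (φ j ∘ compWord φ u) ∘ φ i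
    rw [ih]; rfl

lemma compWord_continuous {Λ : Type*} {φ : Λ → ℝ → ℝ} (hc : ∀ i, Continuous (φ i))
    (u : List Λ) : Continuous (compWord φ u) := by
  induction u with
  | nil => exact continuous_id
  | cons j u ih => exact (hc j).comp ih

lemma compWord_mapsTo {Λ : Type*} {φ : Λ → ℝ → ℝ} (hm : ∀ i, MapsTo (φ i) unitI unitI)
    (u : List Λ) : MapsTo (compWord φ u) unitI unitI := by
  induction u with
  | nil => exact mapsTo_id _
  | cons j u ih => exact (hm j).comp ih

lemma compWord_lipschitz {Λ : Type*} {φ : Λ → ℝ → ℝ} (hm : ∀ i, MapsTo (φ i) unitI unitI)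
    {ρ : ℝ} (hρ0 : 0 ≤ ρ)
    (hρ : ∀ i, ∀ x ∈ unitI, ∀ y ∈ unitI, |φ i x - φ i y| ≤ ρ * |x - y|) (u : List Λ) :
    ∀ x ∈ unitI, ∀ y ∈ unitI, |compWord φ u x - compWord φ u y| ≤ ρ ^ u.length * |x - y| := by
  induction u with
  | nil => intro x _ y _; simp [compWord]
  | cons j u ih =>
    intro x hx y hy
    calc |φ j (compWord φ u x) - φ j (compWord φ u y)|
        ≤ ρ * |compWord φ u x - compWord φ u y| :=
          hρ j _ (compWord_mapsTo hm u hx) _ (compWord_mapsTo hm u hy)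
      _ ≤ ρ * (ρ ^ u.length * |x - y|) := by gcongr; exact ih x hx y hy
      _ = ρ ^ (j :: u).length * |x - y| := by rw [List.length_cons]; ring

lemma abs_sub_le_one_of_mem_unitI {x y : ℝ} (hx : x ∈ unitI) (hy : y ∈ unitI) :
    |x - y| ≤ 1 := by
  have hx' : 0 ≤ x ∧ x ≤ 1 := hx
  have hy' : 0 ≤ y ∧ y ≤ 1 := hy
  rw [abs_le]; constructor <;> linarith

lemma compWord_distortion_aux {Λ : Type*} {φ : Λ → ℝ → ℝ} {d : Λ → ℝ → ℝ}
    (hm : ∀ i, MapsTo (φ i) unitI unitI) {ρ L : ℝ} (hρ0 : 0 ≤ ρ) (hL : 0 ≤ L)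
    (hρ : ∀ i, ∀ x ∈ unitI, ∀ y ∈ unitI, |φ i x - φ i y| ≤ ρ * |x - y|)
    (hmvt : ∀ i, ∀ x ∈ unitI, ∀ y ∈ unitI, ∃ ξ ∈ uIcc x y, φ i x - φ i y = d i ξ * (x - y))
    (hd : ∀ i, ∀ x ∈ unitI, 0 < |d i x|)
    (hdist : ∀ i, ∀ x ∈ unitI, ∀ y ∈ unitI, |d i x| ≤ Real.exp (L * |x - y|) * |d i y|)
    (u : List Λ) :
    ∃ s : ℝ, 0 < s ∧ ∀ x ∈ unitI, ∀ y ∈ unitI,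
      s * |x - y| ≤ |compWord φ u x - compWord φ u y| ∧
      |compWord φ u x - compWord φ u y| ≤
        Real.exp (2 * L * ∑ k ∈ Finset.range u.length, ρ ^ k) * s * |x - y| := by
  induction u with
  | nil => exact ⟨1, one_pos, fun x _ y _ => by simp [compWord]⟩
  | cons j u ih =>
    obtain ⟨s, hs, h⟩ := ih
    have h0 : (0 : ℝ) ∈ unitI := by simp [unitI]
    set b := compWord φ u 0 with hb
    have hbI : b ∈ unitI := compWord_mapsTo hm u h0
    set e := Real.exp (L * ρ ^ u.length) with he
    have he0 : 0 < e := Real.exp_pos _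
    refine ⟨s * (|d j b| / e), mul_pos hs (div_pos (hd j b hbI) he0), fun x hx y hy => ?_⟩
    have hx' := compWord_mapsTo hm u hx
    have hy' := compWord_mapsTo hm u hy
    obtain ⟨ξ, hξ, hξe⟩ := hmvt j _ hx' _ hy'
    have hnear : ∀ z ∈ unitI, compWord φ u z ∈ closedBall b (ρ ^ u.length) := by
      intro z hz
      rw [mem_closedBall, Real.dist_eq]
      calc _ ≤ ρ ^ u.length * |z - 0| := compWord_lipschitz hm hρ0 hρ u z hz 0 h0
        _ ≤ ρ ^ u.length * 1 := by
          gcongr; exact abs_sub_le_one_of_mem_unitI hz h0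
        _ = _ := mul_one _
    have hξI : ξ ∈ unitI := (convex_Icc (0 : ℝ) 1).ordConnected.uIcc_subset hx' hy' hξ
    have hξb : |ξ - b| ≤ ρ ^ u.length := by
      have := (convex_closedBall b (ρ ^ u.length)).ordConnected.uIcc_subset
        (hnear x hx) (hnear y hy) hξ
      rwa [mem_closedBall, Real.dist_eq] at this
    have h1 : |d j ξ| ≤ e * |d j b| :=
      (hdist j ξ hξI b hbI).trans (by rw [he]; gcongr)
    have h2 : |d j b| / e ≤ |d j ξ| := by
      rw [div_le_iff₀ he0, mul_comm]
      refine (hdist j b hbI ξ hξI).trans ?_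
      rw [abs_sub_comm, he]; gcongr
    have heq : |compWord φ (j :: u) x - compWord φ (j :: u) y| =
        |d j ξ| * |compWord φ u x - compWord φ u y| := by
      rw [← abs_mul, ← hξe]; rfl
    rw [heq]
    obtain ⟨hl, hu⟩ := h x hx y hy
    constructor
    · calc s * (|d j b| / e) * |x - y| = (|d j b| / e) * (s * |x - y|) := by ring
        _ ≤ _ := mul_le_mul h2 hl (by positivity) (abs_nonneg _)
    · calc |d j ξ| * |compWord φ u x - compWord φ u y|
          ≤ (e * |d j b|) *
            (Real.exp (2 * L * ∑ k ∈ Finset.range u.length, ρ ^ k) * s * |x - y|) :=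
            mul_le_mul h1 hu (abs_nonneg _) (by positivity)
        _ = _ := by
          have : Real.exp (2 * L * ∑ k ∈ Finset.range (j :: u).length, ρ ^ k) =
              Real.exp (2 * L * ∑ k ∈ Finset.range u.length, ρ ^ k) * e * e := by
            rw [he, ← Real.exp_add, ← Real.exp_add, List.length_cons, Finset.sum_range_succ]
            congr 1; ring
          rw [this]; field_simp

/-- Bounded distortion for compositions of contractions whose derivatives are log-Lipschitz. -/
lemma compWord_distortion {Λ : Type*} {φ : Λ → ℝ → ℝ} {d : Λ → ℝ → ℝ}
    (hm : ∀ i, MapsTo (φ i) unitI unitI) {ρ L : ℝ} (hρ0 : 0 ≤ ρ) (hρ1 : ρ < 1) (hL : 0 ≤ L)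
    (hρ : ∀ i, ∀ x ∈ unitI, ∀ y ∈ unitI, |φ i x - φ i y| ≤ ρ * |x - y|)
    (hmvt : ∀ i, ∀ x ∈ unitI, ∀ y ∈ unitI, ∃ ξ ∈ uIcc x y, φ i x - φ i y = d i ξ * (x - y))
    (hd : ∀ i, ∀ x ∈ unitI, 0 < |d i x|)
    (hdist : ∀ i, ∀ x ∈ unitI, ∀ y ∈ unitI, |d i x| ≤ Real.exp (L * |x - y|) * |d i y|) :
    ∃ K : ℝ, 1 ≤ K ∧ ∀ u : List Λ, ∃ s : ℝ, 0 < s ∧ ∀ x ∈ unitI, ∀ y ∈ unitI,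
      s * |x - y| ≤ |compWord φ u x - compWord φ u y| ∧
      |compWord φ u x - compWord φ u y| ≤ K * s * |x - y| := by
  have h1 : 0 < 1 - ρ := by linarith
  refine ⟨Real.exp (2 * L * (1 - ρ)⁻¹), Real.one_le_exp (by positivity), fun u => ?_⟩
  obtain ⟨s, hs, h⟩ := compWord_distortion_aux hm hρ0 hL hρ hmvt hd hdist u
  refine ⟨s, hs, fun x hx y hy => ⟨(h x hx y hy).1, (h x hx y hy).2.trans ?_⟩⟩
  have : ∑ k ∈ Finset.range u.length, ρ ^ k ≤ (1 - ρ)⁻¹ := by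
    rw [← tsum_geometric_of_lt_one hρ0 hρ1]
    exact (summable_geometric_of_lt_one hρ0 hρ1).sum_le_tsum _ (fun _ _ => by positivity)
  gcongr

/-- `τ` dominates a measure of almost full mass which gives every set `A` of diameter at most `t`
mass at most `κ` times the `τ`-mass of the `r`-neighbourhood of `A`. -/
def NearlySpread (η κ : ENNReal) (r t : ℝ) (τ : Measure ℝ) : Prop :=
  ∃ ν : Measure ℝ, ν ≤ τ ∧ τ univ ≤ ν univ + η ∧
    ∀ A B : Set ℝ, MeasurableSet A → MeasurableSet B →
      (∀ x ∈ A, ∀ y ∈ A, |x - y| ≤ t) →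
      (∀ x ∈ A, ∀ y ∈ unitI, |x - y| ≤ r → y ∈ B) → ν A ≤ κ * τ B

lemma NearlySpread.sum {Λ : Type*} [Fintype Λ] {η κ : ENNReal} {r t : ℝ}
    {w : Λ → ENNReal} (hw : ∑ i, w i = 1) {τ : Λ → Measure ℝ}
    (h : ∀ i, NearlySpread η κ r t (τ i)) : NearlySpread η κ r t (∑ i, w i • τ i) := by
  choose ν hν hmass hAB using h
  refine ⟨∑ i, w i • ν i, ?_, ?_, fun A B hA hB hdA hAB' => ?_⟩
  · refine Finset.sum_le_sum fun i _ => ?_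
    intro s
    simp only [Measure.smul_apply, smul_eq_mul]
    exact mul_le_mul_right (hν i s) _
  · simp only [Measure.finsetSum_apply, Measure.smul_apply, smul_eq_mul]
    calc ∑ i, w i * τ i univ ≤ ∑ i, (w i * ν i univ + w i * η) := by
          refine Finset.sum_le_sum fun i _ => ?_
          rw [← mul_add]; gcongr; exact hmass i
      _ = _ := by rw [Finset.sum_add_distrib, ← Finset.sum_mul, hw, one_mul]
  · simp only [Measure.finsetSum_apply, Measure.smul_apply, smul_eq_mul]
    rw [Finset.mul_sum]
    refine Finset.sum_le_sum fun i _ => ?_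
    rw [mul_left_comm]
    gcongr
    exact hAB i A B hA hB hdA hAB'

lemma measurable_measure_closedBall (μ : Measure ℝ) [IsFiniteMeasure μ] (s : ℝ) :
    Measurable fun y => μ (closedBall y s) := by
  have hS : MeasurableSet {q : ℝ × ℝ | dist q.2 q.1 ≤ s} :=
    (isClosed_le (by fun_prop) continuous_const).measurableSet
  exact measurable_measure_prodMk_left hS

/-- The image of `μ` under a map of diameter at most `r` which contracts by at most `a`. -/
lemma nearlySpread_map {μ : Measure ℝ} [IsProbabilityMeasure μ] (hμI : μ unitIᶜ = 0)
    {η κ : ENNReal} {s : ℝ} (hE : μ {y | κ < μ (closedBall y s)} ≤ η)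
    {f : ℝ → ℝ} (hf : Measurable f) {a r : ℝ} (ha : 0 < a)
    (hlow : ∀ x ∈ unitI, ∀ y ∈ unitI, a * |x - y| ≤ |f x - f y|)
    (hI : MapsTo f unitI unitI)
    (hdiam : ∀ x ∈ unitI, ∀ y ∈ unitI, |f x - f y| ≤ r) :
    NearlySpread η κ r (a * s) (μ.map f) := by
  set E := {y | μ (closedBall y s) ≤ κ} with hEdef
  have hEm : MeasurableSet E :=
    measurableSet_le (measurable_measure_closedBall μ s) measurable_const
  have hEc : Eᶜ = {y | κ < μ (closedBall y s)} := by ext y; simp [hEdef]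
  refine ⟨(μ.restrict E).map f, Measure.map_mono Measure.restrict_le_self hf, ?_, ?_⟩
  · rw [Measure.map_apply hf MeasurableSet.univ, Measure.map_apply hf MeasurableSet.univ]
    simp only [preimage_univ, Measure.restrict_apply MeasurableSet.univ, univ_inter]
    rw [← measure_add_measure_compl hEm, hEc]
    gcongr
  · intro A B hA hB hdA hAB
    rw [Measure.map_apply hf hA, Measure.map_apply hf hB, Measure.restrict_apply (hf hA)]
    have hIm : MeasurableSet unitI := measurableSet_Icc
    have hcut : μ (f ⁻¹' A ∩ E) ≤ μ (f ⁻¹' A ∩ E ∩ unitI) := by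
      have := measure_le_inter_add_sdiff μ (f ⁻¹' A ∩ E) unitI
      have h0 : μ ((f ⁻¹' A ∩ E) \ unitI) = 0 :=
        measure_mono_null (fun x hx => hx.2) hμI
      rwa [h0, add_zero] at this
    refine hcut.trans ?_
    rcases (f ⁻¹' A ∩ E ∩ unitI).eq_empty_or_nonempty with h | ⟨y, ⟨hyA, hyE⟩, hyI⟩
    · rw [h]; simp
    · have h1 : f ⁻¹' A ∩ E ∩ unitI ⊆ closedBall y s := by
        rintro z ⟨⟨hzA, -⟩, hzI⟩
        rw [mem_closedBall, Real.dist_eq]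
        exact le_of_mul_le_mul_left ((hlow z hzI y hyI).trans (hdA _ hzA _ hyA)) ha
      have h2 : μ (f ⁻¹' B) = 1 := by
        rw [prob_compl_eq_zero_iff (hf hB) |>.symm]
        refine measure_mono_null (compl_subset_compl.2 fun z hzI => ?_) hμI
        exact hAB _ hyA _ (hI hzI) (hdiam _ hyI _ hzI)
      rw [h2, mul_one]
      exact (measure_mono h1).trans hyE

/-- A stationary measure is nearly spread at every scale `r ≤ 1`. -/
lemma nearlySpread_stationary {Λ : Type*} [Fintype Λ] {φ : Λ → ℝ → ℝ}
    (hc : ∀ i, Continuous (φ i)) (hm : ∀ i, MapsTo (φ i) unitI unitI)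
    {ρ l K : ℝ} (hρ0 : 0 ≤ ρ) (hρ1 : ρ < 1) (hl0 : 0 < l) (hl1 : l ≤ 1) (hK : 1 ≤ K)
    (hρ : ∀ i, ∀ x ∈ unitI, ∀ y ∈ unitI, |φ i x - φ i y| ≤ ρ * |x - y|)
    (hl : ∀ i, ∀ x ∈ unitI, ∀ y ∈ unitI, l * |x - y| ≤ |φ i x - φ i y|)
    (hdis : ∀ u : List Λ, ∃ s : ℝ, 0 < s ∧ ∀ x ∈ unitI, ∀ y ∈ unitI,
      s * |x - y| ≤ |compWord φ u x - compWord φ u y| ∧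
      |compWord φ u x - compWord φ u y| ≤ K * s * |x - y|)
    {μ : Measure ℝ} [IsProbabilityMeasure μ] (hμI : μ unitIᶜ = 0)
    {w : Λ → ENNReal} (hw : ∑ i, w i = 1) (hμ : μ = ∑ i, w i • μ.map (φ i))
    {η κ : ENNReal} {s : ℝ} (hE : μ {y | κ < μ (closedBall y s)} ≤ η)
    {r : ℝ} (hr0 : 0 < r) (hr1 : r ≤ 1) :
    NearlySpread η κ r (l / K * r * s) μ := by
  have hK0 : 0 < K := by linarith
  obtain ⟨N, hN⟩ := exists_pow_lt_of_lt_one hr0 hρ1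
  have key : ∀ k : ℕ, ∀ u : List Λ, u.length + k = N →
      (∀ x ∈ unitI, ∀ y ∈ unitI, l / K * r * |x - y| ≤ |compWord φ u x - compWord φ u y|) →
      NearlySpread η κ r (l / K * r * s) (μ.map (compWord φ u)) := by
    intro k
    induction k with
    | zero =>
      intro u hu hlow
      refine nearlySpread_map hμI hE (compWord_continuous hc u).measurable (by positivity) hlow
        (compWord_mapsTo hm u) fun x hx y hy => ?_
      refine (compWord_lipschitz hm hρ0 hρ u x hx y hy).trans ?_
      have : u.length = N := by omega
      rw [this]
      calc ρ ^ N * |x - y| ≤ ρ ^ N * 1 := by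
            gcongr; exact abs_sub_le_one_of_mem_unitI hx hy
        _ ≤ r := by linarith
    | succ k ih =>
      intro u hu hlow
      by_cases hdiam : ∀ x ∈ unitI, ∀ y ∈ unitI, |compWord φ u x - compWord φ u y| ≤ r
      · exact nearlySpread_map hμI hE (compWord_continuous hc u).measurable (by positivity) hlow
          (compWord_mapsTo hm u) hdiam
      · push Not at hdiam
        obtain ⟨x₀, hx₀, y₀, hy₀, hxy⟩ := hdiam
        obtain ⟨σ, hσ, hσd⟩ := hdis u
        have hσr : r ≤ K * σ := by
          refine hxy.le.trans ((hσd x₀ hx₀ y₀ hy₀).2.trans ?_)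
          exact mul_le_of_le_one_right (by positivity) (abs_sub_le_one_of_mem_unitI hx₀ hy₀)
        have hmap : μ.map (compWord φ u) = ∑ i, w i • μ.map (compWord φ (u ++ [i])) := by
          conv_lhs => rw [hμ]
          rw [Measure.map_finset_sum (compWord_continuous hc u).measurable.aemeasurable]
          refine Finset.sum_congr rfl fun i _ => ?_
          rw [Measure.map_smul, Measure.map_map (compWord_continuous hc u).measurable
            (hc i).measurable, compWord_append_singleton]
        rw [hmap]
        refine NearlySpread.sum hw fun i => ih (u ++ [i]) (by simp; omega) fun x hx y hy => ?_
        rw [compWord_append_singleton]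
        calc l / K * r * |x - y| ≤ l / K * (K * σ) * |x - y| := by gcongr
          _ = σ * (l * |x - y|) := by field_simp
          _ ≤ σ * |φ i x - φ i y| := by gcongr; exact hl i x hx y hy
          _ ≤ _ := (hσd _ (hm i hx) _ (hm i hy)).1
  have := key N [] (by simp) fun x _ y _ => by
    have h1 : l / K * r ≤ 1 :=
      mul_le_one₀ ((div_le_one hK0).2 (hl1.trans hK)) hr0.le hr1
    simpa [compWord] using mul_le_of_le_one_left (abs_nonneg (x - y)) h1
  simpa [compWord] using this

lemma mem_dyadIco_iff {n : ℕ} {k : ℤ} {x : ℝ} : x ∈ dyadIco n k ↔ ⌊x * 2 ^ n⌋ = k := by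
  have h : (0 : ℝ) < 2 ^ n := by positivity
  rw [dyadIco, mem_Ico, div_le_iff₀ h, lt_div_iff₀ h, Int.floor_eq_iff]

lemma measurableSet_dyadIco (n : ℕ) (k : ℤ) : MeasurableSet (dyadIco n k) := measurableSet_Ico

lemma pairwise_disjoint_dyadIco (n : ℕ) : Pairwise (Function.onFun Disjoint (dyadIco n)) := by
  intro i j hij
  rw [Function.onFun, Set.disjoint_left]
  intro x hi hj
  exact hij ((mem_dyadIco_iff.1 hi).symm.trans (mem_dyadIco_iff.1 hj))

lemma iUnion_dyadIco (n : ℕ) : ⋃ k, dyadIco n k = univ :=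
  eq_univ_of_forall fun _ => mem_iUnion.2 ⟨_, mem_dyadIco_iff.2 rfl⟩

lemma floor_mul_two_pow_add (x : ℝ) (n m : ℕ) :
    ⌊x * 2 ^ (n + m)⌋ / 2 ^ m = ⌊x * 2 ^ n⌋ := by
  have h := Int.floor_div_natCast (x * 2 ^ (n + m)) (2 ^ m)
  push_cast at h
  rw [← h]
  congr 1
  rw [pow_add]; field_simp

lemma mem_Ico_mul_two_pow_iff {m : ℕ} {j k : ℤ} :
    j ∈ Finset.Ico (k * 2 ^ m) ((k + 1) * 2 ^ m) ↔ j / 2 ^ m = k := by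
  have h : (0 : ℤ) < 2 ^ m := by positivity
  rw [Finset.mem_Ico]
  constructor
  · rintro ⟨h1, h2⟩
    have h3 := (Int.le_ediv_iff_mul_le h).2 h1
    have h4 := (Int.ediv_lt_iff_lt_mul h).2 h2
    omega
  · rintro rfl
    exact ⟨(Int.le_ediv_iff_mul_le h).1 le_rfl, (Int.ediv_lt_iff_lt_mul h).1 (by omega)⟩

lemma dyadIco_eq_biUnion (n m : ℕ) (k : ℤ) :
    dyadIco n k = ⋃ j ∈ Finset.Ico (k * 2 ^ m) ((k + 1) * 2 ^ m), dyadIco (n + m) j := by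
  ext x
  simp only [mem_iUnion, mem_Ico_mul_two_pow_iff, mem_dyadIco_iff, exists_prop]
  constructor
  · intro h; exact ⟨_, (floor_mul_two_pow_add x n m).trans h, rfl⟩
  · rintro ⟨j, hj, rfl⟩; exact (floor_mul_two_pow_add x n m).symm.trans hj

lemma dyadIco_subset_of_div_eq {n m : ℕ} {j k : ℤ} (h : j / 2 ^ m = k) :
    dyadIco (n + m) j ⊆ dyadIco n k := by
  intro x hx
  rw [mem_dyadIco_iff] at hx ⊢
  rw [← floor_mul_two_pow_add x n m, hx, h]

lemma measureReal_dyadIco_eq_sum (θ : Measure ℝ) [IsFiniteMeasure θ] (n m : ℕ) (k : ℤ) :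
    θ.real (dyadIco n k) =
      ∑ j ∈ Finset.Ico (k * 2 ^ m) ((k + 1) * 2 ^ m), θ.real (dyadIco (n + m) j) := by
  rw [dyadIco_eq_biUnion n m k, measureReal_biUnion_finset]
  · exact fun i _ j _ hij => pairwise_disjoint_dyadIco _ hij
  · exact fun j _ => measurableSet_dyadIco _ _

lemma hasSum_measureReal_dyadIco (θ : Measure ℝ) [IsFiniteMeasure θ] (n : ℕ) :
    HasSum (fun k => θ.real (dyadIco n k)) (θ.real univ) := by
  have h : θ univ = ∑' k, θ (dyadIco n k) := by
    rw [← iUnion_dyadIco n, measure_iUnion (pairwise_disjoint_dyadIco n)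
      (measurableSet_dyadIco n)]
  have hne : ∑' k, θ (dyadIco n k) ≠ ⊤ := h ▸ measure_ne_top θ univ
  have h2 : θ.real univ = ∑' k, θ.real (dyadIco n k) := by
    rw [Measure.real, h, ENNReal.tsum_toReal_eq fun k => measure_ne_top θ _]; rfl
  rw [h2]
  exact (ENNReal.summable_toReal hne).hasSum

lemma dcomp_dyadIco_toReal (θ : Measure ℝ) {n m : ℕ} (x : ℝ) (j : ℤ) :
    (dcomp θ x n (dyadIco (n + m) j)).toReal =
      if j ∈ Finset.Ico (⌊x * 2 ^ n⌋ * 2 ^ m) ((⌊x * 2 ^ n⌋ + 1) * 2 ^ m) then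
        θ.real (dyadIco (n + m) j) / θ.real (dcell n x) else 0 := by
  rw [dcomp, Measure.smul_apply, smul_eq_mul,
    Measure.restrict_apply (measurableSet_dyadIco _ _), ENNReal.toReal_mul, ENNReal.toReal_inv]
  split_ifs with h
  · rw [mem_Ico_mul_two_pow_iff] at h
    have hsub : dyadIco (n + m) j ⊆ dcell n x := dyadIco_subset_of_div_eq h
    rw [inter_eq_left.2 hsub, inv_mul_eq_div]; rfl
  · have : dyadIco (n + m) j ∩ dcell n x = ∅ := by
      rw [mem_Ico_mul_two_pow_iff] at h
      refine eq_empty_of_forall_notMem fun y hy => h ?_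
      rw [← mem_dyadIco_iff.1 hy.1, floor_mul_two_pow_add, mem_dyadIco_iff.1 hy.2]
    rw [this]; simp

lemma ent1_dcomp (θ : Measure ℝ) (n m : ℕ) (x : ℝ) :
    ent1 (n + m) (dcomp θ x n) =
      -∑ j ∈ Finset.Ico (⌊x * 2 ^ n⌋ * 2 ^ m) ((⌊x * 2 ^ n⌋ + 1) * 2 ^ m),
        θ.real (dyadIco (n + m) j) / θ.real (dcell n x) *
          Real.logb 2 (θ.real (dyadIco (n + m) j) / θ.real (dcell n x)) := by
  rw [ent1, tsum_eq_sum (s := Finset.Ico (⌊x * 2 ^ n⌋ * 2 ^ m) ((⌊x * 2 ^ n⌋ + 1) * 2 ^ m))]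
  · congr 1
    refine Finset.sum_congr rfl fun j hj => ?_
    rw [dcomp_dyadIco_toReal, if_pos hj]
  · intro j hj
    rw [dcomp_dyadIco_toReal, if_neg hj, zero_mul]

/-- A lower bound for the entropy of a finite distribution `a / D`, most of whose mass `b` is
spread out. -/
lemma le_neg_sum_mul_logb {ι : Type*} (F : Finset ι) {a b : ι → ℝ} {D P κ T σ : ℝ}
    (hD : D = ∑ j ∈ F, a j) (hD0 : 0 < D) (ha : ∀ j ∈ F, 0 ≤ a j) (hba : ∀ j ∈ F, b j ≤ a j)
    (hb : ∀ j ∈ F, b j ≤ κ * P) (hP : 0 ≤ P) (hκ : 0 < κ) (hT : 0 < T) (hTκ : T * κ ≤ 1)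
    (hσ : ∑ j ∈ F, (a j - b j) + P / T ≤ σ * D) :
    (1 - σ) * -Real.logb 2 (T * κ) ≤ -∑ j ∈ F, a j / D * Real.logb 2 (a j / D) := by
  classical
  have hlog : 0 ≤ -Real.logb 2 (T * κ) := by
    rw [neg_nonneg]
    exact Real.logb_nonpos one_lt_two (by positivity) hTκ
  set G := F.filter fun j => a j ≤ T * κ * D with hG
  set H := F.filter fun j => ¬ a j ≤ T * κ * D with hH
  have hle : ∀ j ∈ F, a j ≤ D := fun j hj => hD ▸ Finset.single_le_sum ha hj
  have hterm : ∀ j ∈ F, 0 ≤ -(a j / D * Real.logb 2 (a j / D)) := by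
    intro j hj
    rw [neg_nonneg]
    have h0 : 0 ≤ a j / D := div_nonneg (ha j hj) hD0.le
    exact mul_nonpos_of_nonneg_of_nonpos h0
      (Real.logb_nonpos one_lt_two h0 ((div_le_one hD0).2 (hle j hj)))
  have hHsum : ∑ j ∈ H, a j ≤ σ * D := by
    have h1 : ∑ j ∈ H, (a j - b j) ≤ ∑ j ∈ F, (a j - b j) :=
      Finset.sum_le_sum_of_subset_of_nonneg (Finset.filter_subset _ _)
        fun j hj _ => sub_nonneg.2 (hba j hj)
    have h2 : ∑ j ∈ H, b j ≤ P / T := by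
      calc ∑ j ∈ H, b j ≤ ∑ j ∈ H, P / T * (a j / D) := by
            refine Finset.sum_le_sum fun j hj => ?_
            obtain ⟨hjF, hj⟩ := Finset.mem_filter.1 hj
            push Not at hj
            calc b j ≤ κ * P := hb j hjF
              _ = P / T * ((T * κ * D) / D) := by field_simp
              _ ≤ P / T * (a j / D) := by gcongr
        _ = P / T * ((∑ j ∈ H, a j) / D) := by rw [← Finset.mul_sum, Finset.sum_div]
        _ ≤ P / T * 1 := by
            gcongr
            rw [div_le_one hD0, hD]
            exact Finset.sum_le_sum_of_subset_of_nonneg (Finset.filter_subset _ _)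
              fun j hj _ => ha j hj
        _ = P / T := mul_one _
    rw [Finset.sum_sub_distrib] at h1
    linarith
  have hGsum : (1 - σ) * D ≤ ∑ j ∈ G, a j := by
    have := Finset.sum_filter_add_sum_filter_not F (fun j => a j ≤ T * κ * D) a
    rw [← hD] at this
    linarith
  calc (1 - σ) * -Real.logb 2 (T * κ) ≤ (∑ j ∈ G, a j) / D * -Real.logb 2 (T * κ) := by
        gcongr
        rwa [le_div_iff₀ hD0]
    _ = ∑ j ∈ G, a j / D * -Real.logb 2 (T * κ) := by rw [Finset.sum_div, Finset.sum_mul]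
    _ ≤ ∑ j ∈ G, -(a j / D * Real.logb 2 (a j / D)) := by
        refine Finset.sum_le_sum fun j hj => ?_
        obtain ⟨hjF, hj⟩ := Finset.mem_filter.1 hj
        rcases (ha j hjF).eq_or_lt with h | h
        · simp [← h]
        · rw [← mul_neg]
          have h0 : 0 < a j / D := div_pos h hD0
          have : Real.logb 2 (a j / D) ≤ Real.logb 2 (T * κ) :=
            Real.logb_le_logb_of_le one_lt_two h0 ((div_le_iff₀ hD0).2 hj)
          gcongr
    _ ≤ ∑ j ∈ F, -(a j / D * Real.logb 2 (a j / D)) :=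
        Finset.sum_le_sum_of_subset_of_nonneg (Finset.filter_subset _ _) fun j hj _ => hterm j hj
    _ = _ := Finset.sum_neg_distrib _

lemma ent1_dcomp_nonneg (θ : Measure ℝ) [IsFiniteMeasure θ] (n m : ℕ) (x : ℝ) :
    0 ≤ ent1 (n + m) (dcomp θ x n) := by
  rw [ent1_dcomp, ← Finset.sum_neg_distrib]
  refine Finset.sum_nonneg fun j hj => ?_
  rw [neg_nonneg]
  have h0 : 0 ≤ θ.real (dyadIco (n + m) j) / θ.real (dcell n x) := by positivity
  refine mul_nonpos_of_nonneg_of_nonpos h0 (Real.logb_nonpos one_lt_two h0 ?_)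
  exact div_le_one_of_le₀
    (measureReal_mono (dyadIco_subset_of_div_eq (mem_Ico_mul_two_pow_iff.1 hj))) (by positivity)

/-- Most components of `θ` have large entropy if most of `θ` is spread out. -/
lemma measureReal_ent1_dcomp_ge {θ ν : Measure ℝ} [IsProbabilityMeasure θ] (hν : ν ≤ θ)
    {η κ T σ : ℝ} (hη : θ.real univ ≤ ν.real univ + η) (hκ : 0 < κ) (hT : 0 < T)
    (hTκ : T * κ ≤ 1) (hσ : 0 < σ) {n m : ℕ}
    (hsp : ∀ j k : ℤ, j / 2 ^ m = k → ν.real (dyadIco (n + m) j) ≤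
      κ * (θ.real (dyadIco n (k - 1)) + θ.real (dyadIco n k) + θ.real (dyadIco n (k + 1)))) :
    1 - (η + 3 / T) / σ ≤
      θ.real {x | (1 - σ) * -Real.logb 2 (T * κ) ≤ ent1 (n + m) (dcomp θ x n)} := by
  classical
  have : IsFiniteMeasure ν := isFiniteMeasure_of_le θ hν
  set D := fun k : ℤ => θ.real (dyadIco n k) with hDdef
  set N := fun k : ℤ => ν.real (dyadIco n k) with hNdef
  set P := fun k : ℤ => D (k - 1) + D k + D (k + 1) with hPdef
  set e := fun k : ℤ => (D k - N k) + P k / T with hedef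
  have hD0 : ∀ k, 0 ≤ D k := fun k => measureReal_nonneg
  have hP0 : ∀ k, 0 ≤ P k := fun k => by
    have := hD0 (k - 1); have := hD0 k; have := hD0 (k + 1)
    simp only [hPdef]; linarith
  have hND : ∀ k, N k ≤ D k := fun k => by
    refine ENNReal.toReal_mono (measure_ne_top _ _) (hν _)
  have hDs : HasSum D 1 := by simpa using hasSum_measureReal_dyadIco θ n
  have hNs : HasSum N (ν.real univ) := hasSum_measureReal_dyadIco ν n
  have hPs : HasSum P 3 := by
    have h1 : HasSum (D ∘ Equiv.subRight (1 : ℤ)) 1 := (Equiv.hasSum_iff _).2 hDs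
    have h2 : HasSum (D ∘ Equiv.addRight (1 : ℤ)) 1 := (Equiv.hasSum_iff _).2 hDs
    have h3 := (h1.add hDs).add h2
    rw [show (1 : ℝ) + 1 + 1 = 3 by norm_num] at h3
    exact h3
  have hes : HasSum e ((1 - ν.real univ) + 3 / T) := (hDs.sub hNs).add (hPs.div_const T)
  have he0 : ∀ k, 0 ≤ e k := fun k => add_nonneg (sub_nonneg.2 (hND k)) (div_nonneg (hP0 k) hT.le)
  set S := {x | (1 - σ) * -Real.logb 2 (T * κ) ≤ ent1 (n + m) (dcomp θ x n)} with hS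
  set B := {k : ℤ | σ * D k ≤ e k} with hB
  have hsub : (⋃ k : B, dyadIco n (k : ℤ))ᶜ ⊆ S := by
    intro x hx
    set k := ⌊x * 2 ^ n⌋ with hk
    have hkB : e k < σ * D k := by
      by_contra! h
      exact hx (mem_iUnion.2 ⟨⟨k, h⟩, mem_dyadIco_iff.2 hk.symm⟩)
    have hDk : 0 < D k := by
      by_contra! h
      have : D k = 0 := le_antisymm h (hD0 k)
      rw [this, mul_zero] at hkB
      exact absurd (he0 k) (not_le.2 hkB)
    rw [hS, mem_ofPred_eq, ent1_dcomp]
    refine le_neg_sum_mul_logb (P := P k) (b := fun j => ν.real (dyadIco (n + m) j))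
      _ (measureReal_dyadIco_eq_sum θ n m k) hDk (fun j _ => measureReal_nonneg)
      (fun j _ => ENNReal.toReal_mono (measure_ne_top _ _) (hν _))
      (fun j hj => hsp j k (mem_Ico_mul_two_pow_iff.1 hj)) (hP0 k) hκ hT hTκ ?_
    rw [Finset.sum_sub_distrib, ← measureReal_dyadIco_eq_sum, ← measureReal_dyadIco_eq_sum]
    exact hkB.le
  have hBad : θ.real (⋃ k : B, dyadIco n (k : ℤ)) ≤ (η + 3 / T) / σ := by
    have hms : ∀ k : B, MeasurableSet (dyadIco n (k : ℤ)) := fun k => measurableSet_dyadIco _ _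
    have hdisj : Pairwise (Function.onFun Disjoint fun k : B => dyadIco n (k : ℤ)) :=
      fun i j hij => pairwise_disjoint_dyadIco n (Subtype.coe_injective.ne hij)
    rw [Measure.real, measure_iUnion hdisj hms,
      ENNReal.tsum_toReal_eq fun k => measure_ne_top θ _]
    have hes' : Summable fun k : B => e k / σ := (hes.summable.subtype B).div_const σ
    calc ∑' k : B, D k ≤ ∑' k : B, e k / σ := by
          refine Summable.tsum_le_tsum (fun k => ?_) (hDs.summable.subtype B) hes'
          rw [le_div_iff₀ hσ, mul_comm]
          exact k.2
      _ = (∑' k : B, e k) / σ := tsum_div_const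
      _ ≤ (∑' k, e k) / σ := by
          gcongr
          exact hes.summable.tsum_subtype_le e B he0
      _ ≤ (η + 3 / T) / σ := by
          rw [hes.tsum_eq]
          have : θ.real univ = 1 := by simp
          gcongr
          linarith
  have hm : MeasurableSet (⋃ k : B, dyadIco n (k : ℤ)) :=
    MeasurableSet.iUnion fun k => measurableSet_dyadIco _ _
  calc 1 - (η + 3 / T) / σ ≤ 1 - θ.real (⋃ k : B, dyadIco n (k : ℤ)) := by linarith
    _ = θ.real (⋃ k : B, dyadIco n (k : ℤ))ᶜ := (probReal_compl_eq_one_sub hm).symm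
    _ ≤ θ.real S := measureReal_mono hsub

lemma exists_sub_eq_deriv_mul {f f' : ℝ → ℝ} (hc : ContinuousOn f unitI)
    (hd : ∀ x ∈ Ioo (0 : ℝ) 1, HasDerivAt f (f' x) x) :
    ∀ x ∈ unitI, ∀ y ∈ unitI, ∃ ξ ∈ uIcc x y, f x - f y = f' ξ * (x - y) := by
  have key : ∀ x ∈ unitI, ∀ y ∈ unitI, x < y → ∃ ξ ∈ uIcc x y, f x - f y = f' ξ * (x - y) := by
    intro x hx y hy hxy
    obtain ⟨ξ, hξ, h⟩ := exists_hasDerivAt_eq_slope f f' hxy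
      (hc.mono (Icc_subset_Icc hx.1 hy.2))
      fun z hz => hd z ⟨hx.1.trans_lt hz.1, hz.2.trans_le hy.2⟩
    refine ⟨ξ, by rw [uIcc_of_le hxy.le]; exact Ioo_subset_Icc_self hξ, ?_⟩
    have : y - x ≠ 0 := (sub_pos.2 hxy).ne'
    rw [h]; field_simp; ring
  intro x hx y hy
  rcases lt_trichotomy x y with h | h | h
  · exact key x hx y hy h
  · exact ⟨x, left_mem_uIcc, by simp [h]⟩
  · obtain ⟨ξ, hξ, e⟩ := key y hy x hx h
    exact ⟨ξ, by rwa [uIcc_comm], by linarith⟩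

lemma uIcc_subset_unitI {x y : ℝ} (hx : x ∈ unitI) (hy : y ∈ unitI) : uIcc x y ⊆ unitI :=
  (convex_Icc (0 : ℝ) 1).ordConnected.uIcc_subset hx hy

/-- The retraction of `ℝ` onto the unit interval. -/
def clampI (x : ℝ) : ℝ := projIcc (0 : ℝ) 1 zero_le_one x

lemma clampI_mem (x : ℝ) : clampI x ∈ unitI := (projIcc (0 : ℝ) 1 zero_le_one x).2

lemma clampI_of_mem {x : ℝ} (hx : x ∈ unitI) : clampI x = x := by
  rw [clampI, projIcc_of_mem zero_le_one hx]

lemma continuous_comp_clampI {f : ℝ → ℝ} (hf : ContinuousOn f unitI) :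
    Continuous (f ∘ clampI) :=
  hf.comp_continuous (continuous_subtype_val.comp continuous_projIcc) clampI_mem

lemma map_comp_clampI {μ : Measure ℝ} (hμI : μ unitIᶜ = 0) (f : ℝ → ℝ) :
    μ.map (f ∘ clampI) = μ.map f := by
  refine Measure.map_congr ?_
  have : ∀ᵐ x ∂μ, x ∈ unitI := hμI
  filter_upwards [this] with x hx
  simp [clampI_of_mem hx]

/-- A self-conformal measure is nearly spread at every scale `r ≤ 1`. -/
lemma exists_nearlySpread_selfConformal {Λ : Type} [Fintype Λ] [Nonempty Λ]
    (φ : Λ → ℝ → ℝ) (hanal : ∀ i, AnalyticOnNhd ℝ (φ i) unitI)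
    (hmaps : ∀ i, Set.MapsTo (φ i) unitI unitI)
    (hderiv : ∀ i, ∀ x ∈ unitI, 0 < |deriv (φ i) x| ∧ |deriv (φ i) x| < 1)
    (p : Λ → ℝ) (hp : ∀ i, 0 < p i) (hp1 : ∑ i, p i = 1)
    (μ : Measure ℝ) [IsProbabilityMeasure μ] (hμI : μ unitIᶜ = 0)
    (hμ : μ = ∑ i : Λ, ENNReal.ofReal (p i) • Measure.map (φ i) μ) :
    ∃ c : ℝ, 0 < c ∧ ∀ (η κ : ENNReal) (s : ℝ), μ {y | κ < μ (closedBall y s)} ≤ η →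
      ∀ r : ℝ, 0 < r → r ≤ 1 → NearlySpread η κ r (c * r * s) μ := by
  have hIc : IsCompact unitI := isCompact_Icc
  have hIne : unitI.Nonempty := ⟨0, by simp [unitI]⟩
  have hcont : ∀ i, ContinuousOn (φ i) unitI := fun i => (hanal i).continuousOn
  have hdcont : ∀ i, ContinuousOn (fun x => |deriv (φ i) x|) unitI :=
    fun i => (hanal i).deriv.continuousOn.abs
  have hmin : ∀ i, ∃ l : ℝ, 0 < l ∧ ∀ x ∈ unitI, l ≤ |deriv (φ i) x| := by
    intro i
    obtain ⟨x, hx, h⟩ := hIc.exists_isMinOn hIne (hdcont i)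
    exact ⟨_, (hderiv i x hx).1, fun y hy => h hy⟩
  have hmax : ∀ i, ∃ ρ : ℝ, ρ < 1 ∧ ∀ x ∈ unitI, |deriv (φ i) x| ≤ ρ := by
    intro i
    obtain ⟨x, hx, h⟩ := hIc.exists_isMaxOn hIne (hdcont i)
    exact ⟨_, (hderiv i x hx).2, fun y hy => h hy⟩
  have hmax2 : ∀ i, ∃ L : ℝ, ∀ x ∈ unitI, |deriv (deriv (φ i)) x| ≤ L := by
    intro i
    obtain ⟨x, hx, h⟩ := hIc.exists_isMaxOn hIne (hanal i).deriv.deriv.continuousOn.abs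
    exact ⟨_, fun y hy => h hy⟩
  choose l hl0 hl using hmin
  choose ρ hρ1 hρ using hmax
  choose L hL using hmax2
  obtain ⟨il, hil⟩ := Finite.exists_min l
  obtain ⟨iρ, hiρ⟩ := Finite.exists_max ρ
  obtain ⟨iL, hiL⟩ := Finite.exists_max L
  have h0 : (0 : ℝ) ∈ unitI := by simp [unitI]
  have hρ0 : 0 ≤ ρ iρ := (abs_nonneg _).trans (hρ iρ 0 h0)
  have hL0 : 0 ≤ L iL := (abs_nonneg _).trans (hL iL 0 h0)
  have hl1 : l il ≤ 1 := (hl il 0 h0).trans (hderiv il 0 h0).2.le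
  have hIoo : Ioo (0 : ℝ) 1 ⊆ unitI := Ioo_subset_Icc_self
  have hmvt : ∀ i, ∀ x ∈ unitI, ∀ y ∈ unitI, ∃ ξ ∈ uIcc x y,
      φ i x - φ i y = deriv (φ i) ξ * (x - y) := fun i =>
    exists_sub_eq_deriv_mul (hcont i) fun x hx =>
      ((hanal i) x (hIoo hx)).differentiableAt.hasDerivAt
  have hdist : ∀ i, ∀ x ∈ unitI, ∀ y ∈ unitI,
      |deriv (φ i) x| ≤ Real.exp (L iL / l il * |x - y|) * |deriv (φ i) y| := by
    intro i x hx y hy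
    obtain ⟨ξ, hξ, h⟩ := exists_sub_eq_deriv_mul (hanal i).deriv.continuousOn
      (fun x hx => ((hanal i).deriv x (hIoo hx)).differentiableAt.hasDerivAt) x hx y hy
    have h1 : |deriv (φ i) x - deriv (φ i) y| ≤ L iL * |x - y| := by
      rw [h, abs_mul]
      gcongr
      exact (hL i ξ (uIcc_subset_unitI hx hy hξ)).trans (hiL i)
    have h2 : |deriv (φ i) x| ≤ |deriv (φ i) y| + L iL * |x - y| := by
      have := abs_sub_abs_le_abs_sub (deriv (φ i) x) (deriv (φ i) y)
      linarith
    have h3 : l il ≤ |deriv (φ i) y| := (hil i).trans (hl i y hy)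
    have hlp : 0 < l il := hl0 il
    calc |deriv (φ i) x| ≤ |deriv (φ i) y| + L iL * |x - y| := h2
      _ = |deriv (φ i) y| + L iL / l il * |x - y| * l il := by field_simp
      _ ≤ |deriv (φ i) y| + L iL / l il * |x - y| * |deriv (φ i) y| := by gcongr
      _ = (L iL / l il * |x - y| + 1) * |deriv (φ i) y| := by ring
      _ ≤ _ := by gcongr; exact Real.add_one_le_exp _
  set g : Λ → ℝ → ℝ := fun i => φ i ∘ clampI with hg
  have hgI : ∀ i, ∀ x ∈ unitI, g i x = φ i x := fun i x hx => by simp [hg, clampI_of_mem hx]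
  have hgm : ∀ i, MapsTo (g i) unitI unitI := fun i x _ => hmaps i (clampI_mem x)
  have hgmvt : ∀ i, ∀ x ∈ unitI, ∀ y ∈ unitI, ∃ ξ ∈ uIcc x y,
      g i x - g i y = deriv (φ i) ξ * (x - y) := fun i x hx y hy => by
    rw [hgI i x hx, hgI i y hy]; exact hmvt i x hx y hy
  have hgρ : ∀ i, ∀ x ∈ unitI, ∀ y ∈ unitI, |g i x - g i y| ≤ ρ iρ * |x - y| := by
    intro i x hx y hy
    obtain ⟨ξ, hξ, h⟩ := hgmvt i x hx y hy
    rw [h, abs_mul]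
    gcongr
    exact (hρ i ξ (uIcc_subset_unitI hx hy hξ)).trans (hiρ i)
  have hgl : ∀ i, ∀ x ∈ unitI, ∀ y ∈ unitI, l il * |x - y| ≤ |g i x - g i y| := by
    intro i x hx y hy
    obtain ⟨ξ, hξ, h⟩ := hgmvt i x hx y hy
    rw [h, abs_mul]
    gcongr
    exact (hil i).trans (hl i ξ (uIcc_subset_unitI hx hy hξ))
  obtain ⟨K, hK, hdis⟩ := compWord_distortion hgm hρ0 (hρ1 iρ) (div_nonneg hL0 (hl0 il).le)
    hgρ hgmvt (fun i x hx => (hderiv i x hx).1) hdist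
  have hw : ∑ i, ENNReal.ofReal (p i) = 1 := by
    rw [← ENNReal.ofReal_sum_of_nonneg fun i _ => (hp i).le, hp1, ENNReal.ofReal_one]
  have hμg : μ = ∑ i, ENNReal.ofReal (p i) • μ.map (g i) := by
    simpa only [hg, map_comp_clampI hμI] using hμ
  exact ⟨l il / K, div_pos (hl0 il) (by linarith), fun η κ s hE r hr0 hr1 =>
    nearlySpread_stationary (fun i => continuous_comp_clampI (hcont i)) hgm hρ0 (hρ1 iρ)
      (hl0 il) hl1 hK hgρ hgl hdis hμI hw hμg hE hr0 hr1⟩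

/-- An exact dimensional measure gives small mass to most small balls. -/
lemma ExactDimWith.eventually_measure_le {μ : Measure ℝ} [IsProbabilityMeasure μ] {d : ℝ}
    (hdim : ExactDimWith μ d) {C σ η : ℝ} (hC : 0 < C) (hσ : 0 < σ) (hη : 0 < η) :
    ∀ᶠ m : ℕ in atTop, μ {y | ENNReal.ofReal ((C * (2 ^ m)⁻¹) ^ (d - σ)) <
      μ (closedBall y (C * (2 ^ m)⁻¹))} ≤ ENNReal.ofReal η := by
  set s : ℕ → ℝ := fun m => C * (2 ^ m)⁻¹ with hs
  have hs0 : ∀ m, 0 < s m := fun m => by positivity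
  have hst : Tendsto s atTop (𝓝 0) := by
    have h : Tendsto (fun m : ℕ => ((2 : ℝ) ^ m)⁻¹) atTop (𝓝 0) :=
      tendsto_inv_atTop_zero.comp (tendsto_pow_atTop_atTop_of_one_lt one_lt_two)
    simpa using h.const_mul C
  have hst' : Tendsto s atTop (𝓝[>] 0) :=
    tendsto_nhdsWithin_iff.2 ⟨hst, Eventually.of_forall hs0⟩
  set f : ℕ → ℝ → ℝ := fun m y =>
    Real.log (μ (closedBall y (s m))).toReal / Real.log (s m) with hf
  have hfm : ∀ m, AEStronglyMeasurable (f m) μ := fun m =>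
    ((Real.measurable_log.comp (measurable_measure_closedBall μ (s m)).ennreal_toReal).div_const
      _).aestronglyMeasurable
  have hae : ∀ᵐ y ∂μ, Tendsto (fun m => f m y) atTop (𝓝 d) := by
    filter_upwards [hdim] with y hy
    exact hy.comp hst'
  have hmeas := tendstoInMeasure_of_tendsto_ae hfm hae (ENNReal.ofReal σ) (by simpa using hσ)
  filter_upwards [hmeas.eventually_le_const (ENNReal.ofReal_pos.2 hη),
    hst.eventually_lt_const one_pos] with m hm hm1
  refine (measure_mono fun y hy => ?_).trans hm
  have hy : ENNReal.ofReal (s m ^ (d - σ)) < μ (closedBall y (s m)) := hy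
  have hlt : s m ^ (d - σ) < (μ (closedBall y (s m))).toReal :=
    (ENNReal.ofReal_lt_iff_lt_toReal (by have := hs0 m; positivity) (measure_ne_top _ _)).1 hy
  have hlog : Real.log (s m) < 0 := Real.log_neg (hs0 m) hm1
  have h1 : (d - σ) * Real.log (s m) < Real.log (μ (closedBall y (s m))).toReal := by
    rw [← Real.log_rpow (hs0 m)]
    exact Real.log_lt_log (Real.rpow_pos_of_pos (hs0 m) _) hlt
  have h2 : f m y < d - σ := (div_lt_iff_of_neg hlog).2 h1
  change ENNReal.ofReal σ ≤ edist (f m y) d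
  rw [edist_dist, Real.dist_eq]
  refine ENNReal.ofReal_le_ofReal ?_
  rw [abs_sub_comm]
  exact le_trans (by linarith) (le_abs_self _)

lemma abs_sub_le_of_mem_dyadIco {n : ℕ} {k : ℤ} {x y : ℝ} (hx : x ∈ dyadIco n k)
    (hy : y ∈ dyadIco n k) : |x - y| ≤ (2 ^ n)⁻¹ := by
  obtain ⟨h1, h2⟩ := hx
  obtain ⟨h3, h4⟩ := hy
  rw [add_div, one_div] at h2 h4
  rw [abs_le]; constructor <;> linarith

lemma mem_dyadIco_neighbours {n : ℕ} {k : ℤ} {x y : ℝ} (hx : x ∈ dyadIco n k)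
    (hxy : |x - y| ≤ (2 ^ n)⁻¹) :
    y ∈ dyadIco n (k - 1) ∪ dyadIco n k ∪ dyadIco n (k + 1) := by
  have h2 : (0 : ℝ) < 2 ^ n := by positivity
  have h3 : |x * 2 ^ n - y * 2 ^ n| ≤ 1 := by
    rw [← sub_mul, abs_mul, abs_of_pos h2]
    calc |x - y| * 2 ^ n ≤ (2 ^ n)⁻¹ * 2 ^ n := by gcongr
      _ = 1 := inv_mul_cancel₀ h2.ne'
  rw [abs_le] at h3
  simp only [mem_union, mem_dyadIco_iff] at hx ⊢
  rw [Int.floor_eq_iff] at hx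
  have h4 : k - 1 ≤ ⌊y * 2 ^ n⌋ := by
    rw [Int.le_floor]; push_cast; linarith
  have h5 : ⌊y * 2 ^ n⌋ < k + 2 := by
    rw [Int.floor_lt]; push_cast; linarith
  omega

/-- Under a bi-Lipschitz image, the spreading property passes to dyadic cells. -/
lemma NearlySpread.le_measureReal_ent1_dcomp {μ : Measure ℝ} [IsProbabilityMeasure μ]
    (hμI : μ unitIᶜ = 0) {ε : ℝ} (hε : 0 < ε) {g : ℝ → ℝ} (hg : Continuous g)
    (hlow : ∀ x ∈ unitI, ∀ y ∈ unitI, ε * |x - y| ≤ |g x - g y|)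
    (hup : ∀ x ∈ unitI, ∀ y ∈ unitI, |g x - g y| ≤ ε⁻¹ * |x - y|)
    {n m : ℕ} {η κ T σ r t : ℝ} (hη : 0 ≤ η) (hκ : 0 < κ) (hT : 0 < T) (hTκ : T * κ ≤ 1)
    (hσ : 0 < σ) (hr : r = ε * (2 ^ n)⁻¹) (ht : t = ε⁻¹ * (2 ^ (n + m))⁻¹)
    (h : NearlySpread (ENNReal.ofReal η) (ENNReal.ofReal κ) r t μ) :
    1 - (η + 3 / T) / σ ≤ (μ.map g).real
      {x | (1 - σ) * -Real.logb 2 (T * κ) ≤ ent1 (n + m) (dcomp (μ.map g) x n)} := by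
  obtain ⟨ν, hν, hmass, hAB⟩ := h
  have hgm := hg.measurable
  have : IsFiniteMeasure ν := isFiniteMeasure_of_le μ hν
  have : IsProbabilityMeasure (μ.map g) := Measure.isProbabilityMeasure_map hgm.aemeasurable
  have hIm : MeasurableSet unitI := measurableSet_Icc
  refine measureReal_ent1_dcomp_ge (Measure.map_mono hν hgm) ?_ hκ hT hTκ hσ fun j k hjk => ?_
  · rw [map_measureReal_apply hgm MeasurableSet.univ, map_measureReal_apply hgm MeasurableSet.univ,
      preimage_univ, Measure.real, Measure.real, ← ENNReal.toReal_ofReal hη,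
      ← ENNReal.toReal_add (measure_ne_top _ _) ENNReal.ofReal_ne_top]
    exact ENNReal.toReal_mono (by finiteness) hmass
  · set N := dyadIco n (k - 1) ∪ dyadIco n k ∪ dyadIco n (k + 1) with hN
    have hNm : MeasurableSet N := ((measurableSet_dyadIco _ _).union
      (measurableSet_dyadIco _ _)).union (measurableSet_dyadIco _ _)
    have hAm : MeasurableSet (g ⁻¹' dyadIco (n + m) j) := hgm (measurableSet_dyadIco _ _)
    have hle := hAB (g ⁻¹' dyadIco (n + m) j ∩ unitI) (g ⁻¹' N) (hAm.inter hIm) (hgm hNm)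
      (by
        rintro x ⟨hx, hxI⟩ y ⟨hy, hyI⟩
        rw [ht, inv_mul_eq_div, le_div_iff₀ hε, mul_comm]
        exact (hlow x hxI y hyI).trans (abs_sub_le_of_mem_dyadIco hx hy))
      (by
        rintro x ⟨hx, hxI⟩ y hyI hxy
        refine mem_dyadIco_neighbours (dyadIco_subset_of_div_eq hjk hx)
          ((hup x hxI y hyI).trans ?_)
        rw [inv_mul_le_iff₀ hε, ← hr]
        exact hxy)
    have hνI : ν (g ⁻¹' dyadIco (n + m) j) = ν (g ⁻¹' dyadIco (n + m) j ∩ unitI) := by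
      have h0 : ν unitIᶜ = 0 := le_antisymm ((hν _).trans hμI.le) bot_le
      exact (measure_inter_conull h0).symm
    rw [← hνI] at hle
    have hle' : (ν.map g).real (dyadIco (n + m) j) ≤ κ * (μ.map g).real N := by
      rw [map_measureReal_apply hgm (measurableSet_dyadIco _ _), map_measureReal_apply hgm hNm]
      have := ENNReal.toReal_mono (by finiteness) hle
      rwa [ENNReal.toReal_mul, ENNReal.toReal_ofReal hκ.le] at this
    refine hle'.trans ?_
    gcongr
    exact (measureReal_union_le _ _).trans (by gcongr; exact measureReal_union_le _ _)

theorem component_entropy_lower_bound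
    {Λ : Type} [Fintype Λ] [Nonempty Λ]
    (φ : Λ → ℝ → ℝ)
    (hanal : ∀ i, AnalyticOnNhd ℝ (φ i) unitI)
    (hmaps : ∀ i, Set.MapsTo (φ i) unitI unitI)
    (hderiv : ∀ i, ∀ x ∈ unitI, 0 < |deriv (φ i) x| ∧ |deriv (φ i) x| < 1)
    (hnofix : ¬ ∃ x ∈ unitI, ∀ i, φ i x = x)
    (p : Λ → ℝ) (hp : ∀ i, 0 < p i) (hp1 : ∑ i, p i = 1)
    (μ : Measure ℝ) (hprob : IsProbabilityMeasure μ) (hμI : μ unitIᶜ = 0)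
    (hμ : μ = ∑ i : Λ, ENNReal.ofReal (p i) • Measure.map (φ i) μ)
    (dμ : ℝ) (hdim : ExactDimWith μ dμ) :
    ∀ ε : ℝ, 0 < ε → ε < 1 →
      ∃ M : ℕ, 1 ≤ M ∧ ∀ m : ℕ, M ≤ m → ∀ n : ℕ, 1 ≤ n →
        ∀ ψ : ℝ → ℝ, ContDiffOn ℝ 1 ψ unitI →
          (∀ x ∈ unitI, ε ≤ |derivWithin ψ unitI x| ∧ |derivWithin ψ unitI x| ≤ ε⁻¹) →
          1 - ε < ((μ.map ψ)
            {x | dμ - ε < (1 / (m : ℝ)) * ent1 (n + m) (dcomp (μ.map ψ) x n)}).toReal := by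
  intro ε hε hε1
  rcases lt_or_ge dμ ε with hd | hd
  · refine ⟨1, le_rfl, fun m _ n _ ψ hψ _ => ?_⟩
    rw [← map_comp_clampI hμI ψ]
    have : IsProbabilityMeasure (μ.map (ψ ∘ clampI)) := Measure.isProbabilityMeasure_map
      (continuous_comp_clampI hψ.continuousOn).measurable.aemeasurable
    have huniv : {x | dμ - ε < (1 / (m : ℝ)) *
        ent1 (n + m) (dcomp (μ.map (ψ ∘ clampI)) x n)} = univ := by
      refine eq_univ_of_forall fun x => ?_
      have h := ent1_dcomp_nonneg (μ.map (ψ ∘ clampI)) n m x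
      exact (sub_neg.2 hd).trans_le (by positivity)
    rw [huniv, measure_univ, ENNReal.toReal_one]
    linarith
  obtain ⟨c, hc, hspread⟩ :=
    exists_nearlySpread_selfConformal φ hanal hmaps hderiv p hp hp1 μ hμI hμ
  have hd0 : 0 < dμ := hε.trans_le hd
  set σ := ε / (2 * (dμ + 1)) with hσdef
  have hσ0 : 0 < σ := by positivity
  have hσeq : σ * (dμ + 1) = ε / 2 := by rw [hσdef]; field_simp
  have hσd : σ < dμ := by nlinarith
  have hσ1 : σ < 1 := by nlinarith
  set η := σ * ε / 4 with hηdef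
  have hη0 : 0 < η := by positivity
  set T := 3 / η with hTdef
  have hT0 : 0 < T := by positivity
  set C := ε⁻¹ * ε⁻¹ * c⁻¹ with hCdef
  have hC0 : 0 < C := by positivity
  set b := Real.logb 2 T + (dμ - σ) * Real.logb 2 C with hb
  obtain ⟨M₀, hM₀⟩ := eventually_atTop.1 (hdim.eventually_measure_le hC0 hσ0 hη0)
  obtain ⟨M₁, hM₁⟩ := exists_nat_gt (2 * |b| / ε)
  obtain ⟨M₂, hM₂⟩ := exists_nat_gt (|b| / (dμ - σ))
  refine ⟨max 1 (max M₀ (max M₁ M₂)), le_max_left _ _, fun m hm n _ ψ hψ hψd => ?_⟩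
  simp only [max_le_iff] at hm
  obtain ⟨hm1, hm0, hmM₁, hmM₂⟩ := hm
  have hmpos : (0 : ℝ) < m := by exact_mod_cast hm1
  have hb1 : 2 * |b| / ε < m := hM₁.trans_le (by exact_mod_cast hmM₁)
  have hb2 : |b| / (dμ - σ) < m := hM₂.trans_le (by exact_mod_cast hmM₂)
  rw [div_lt_iff₀ hε] at hb1
  rw [div_lt_iff₀ (sub_pos.2 hσd)] at hb2
  set s := C * (2 ^ m)⁻¹ with hs
  have hs0 : 0 < s := by positivity
  set κ := s ^ (dμ - σ) with hκ
  have hκ0 : 0 < κ := Real.rpow_pos_of_pos hs0 _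
  have hlog : Real.logb 2 (T * κ) = b - m * (dμ - σ) := by
    rw [Real.logb_mul hT0.ne' hκ0.ne', hκ, Real.logb_rpow_eq_mul_logb_of_pos hs0, hs,
      Real.logb_mul hC0.ne' (by positivity), Real.logb_inv, Real.logb_pow,
      Real.logb_self_eq_one one_lt_two, hb]
    ring
  have hTκ : T * κ ≤ 1 := by
    rw [← Real.logb_nonpos_iff one_lt_two (by positivity), hlog]
    have := le_abs_self b
    linarith
  have hψd' : ∀ x ∈ unitI, ∀ y ∈ unitI, ∃ ξ ∈ unitI,
      (ψ ∘ clampI) x - (ψ ∘ clampI) y = derivWithin ψ unitI ξ * (x - y) := by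
    intro x hx y hy
    obtain ⟨ξ, hξ, h⟩ := exists_sub_eq_deriv_mul (f' := derivWithin ψ unitI) hψ.continuousOn
      (fun z hz => ((hψ.differentiableOn one_ne_zero z
        (Ioo_subset_Icc_self hz)).hasDerivWithinAt).hasDerivAt
          (Icc_mem_nhds hz.1 hz.2)) x hx y hy
    refine ⟨ξ, uIcc_subset_unitI hx hy hξ, ?_⟩
    simpa [clampI_of_mem hx, clampI_of_mem hy] using h
  have hr1 : ε * (2 ^ n)⁻¹ ≤ 1 :=
    mul_le_one₀ hε1.le (by positivity) (inv_le_one_of_one_le₀ (one_le_pow₀ one_le_two))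
  have hmain := NearlySpread.le_measureReal_ent1_dcomp hμI hε
    (continuous_comp_clampI hψ.continuousOn)
    (fun x hx y hy => by
      obtain ⟨ξ, hξ, h⟩ := hψd' x hx y hy
      rw [h, abs_mul]
      gcongr
      exact (hψd ξ hξ).1)
    (fun x hx y hy => by
      obtain ⟨ξ, hξ, h⟩ := hψd' x hx y hy
      rw [h, abs_mul]
      gcongr
      exact (hψd ξ hξ).2)
    (m := m) hη0.le hκ0 hT0 hTκ hσ0 rfl
    (show c * (ε * (2 ^ n)⁻¹) * s = _ by
      rw [hs, hCdef, pow_add]; field_simp)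
    (hspread _ _ s (hM₀ m hm0) _ (by positivity) hr1)
  rw [map_comp_clampI hμI ψ] at hmain
  have hprobψ : IsProbabilityMeasure (μ.map ψ) := by
    rw [← map_comp_clampI hμI ψ]
    exact Measure.isProbabilityMeasure_map
      (continuous_comp_clampI hψ.continuousOn).measurable.aemeasurable
  have hsmall : (η + 3 / T) / σ = ε / 2 := by
    rw [hTdef, hηdef]; field_simp; norm_num
  rw [hsmall] at hmain
  refine lt_of_lt_of_le (by linarith) (hmain.trans (measureReal_mono fun x hx => ?_))
  have hx : (1 - σ) * -Real.logb 2 (T * κ) ≤ ent1 (n + m) (dcomp (μ.map ψ) x n) := hx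
  change dμ - ε < 1 / (m : ℝ) * ent1 (n + m) (dcomp (μ.map ψ) x n)
  rw [one_div, inv_mul_eq_div, lt_div_iff₀ hmpos]
  refine lt_of_lt_of_le ?_ hx
  rw [hlog]
  have h1 : (1 - σ) * b ≤ |b| :=
    (mul_le_mul_of_nonneg_left (le_abs_self b) (by linarith)).trans
      (mul_le_of_le_one_left (abs_nonneg b) (by linarith))
  have h2 : dμ - ε / 2 ≤ (1 - σ) * (dμ - σ) := by nlinarith
  have h3 := mul_le_mul_of_nonneg_right h2 hmpos.le
  nlinarith
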